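/- arXiv:math/0604105 — 2 statements merged into one kernel-verified Lean document; each statement's English description precedes it below -/
import Mathlib

section
/- Let Γ be an inverse semigroup with zero. If p, p₁, …, pₙ ∈ Γ⁽⁰⁾ satisfy p < (p₁,…,pₙ) and p ≺ x⁻¹·x for some x ∈ Γ, then x·p·x⁻¹ < (x·p₁·x⁻¹, …, x·pₙ·x⁻¹). -/
/-- An inverse semigroup: a semigroup in which every element `x` has a unique
element `x⁻¹` with `x * x⁻¹ * x = x` and `x⁻¹ * x * x⁻¹ = x⁻¹`. -/
class InverseSemigroup (α : Type*) extends Semigroup α, Inv α where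
  mul_inv_mul : ∀ x : α, x * x⁻¹ * x = x
  inv_mul_inv : ∀ x : α, x⁻¹ * x * x⁻¹ = x⁻¹
  inv_unique : ∀ x y : α, x * y * x = x → y * x * y = y → y = x⁻¹

variable {α : Type*} [InverseSemigroup α]

/-- The natural order on an inverse semigroup: `x ≺ y` iff `x * y⁻¹ = x * x⁻¹`. -/
def prec (x y : α) : Prop := x * y⁻¹ = x * x⁻¹

/-- The idempotents (units) `Γ⁽⁰⁾`: elements `p` with `p = p * p⁻¹`. -/
def IsIdem (p : α) : Prop := p = p * p⁻¹

/-- A zero element: `z * x = z = x * z` for every `x`. -/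
def IsZeroEl (z : α) : Prop := ∀ x : α, z * x = z ∧ x * z = z


/-- The relation x < (x₁,…,xₙ) (w.r.t. the zero z0), with the finite family
given as a finset: every nonzero precessor of x has a nonzero common precessor
with some member of s. -/
def ltS (z0 x : α) (s : Finset α) : Prop :=
  ∀ y : α, prec y x → y ≠ z0 → ∃ t ∈ s, ∃ w : α, w ≠ z0 ∧ prec w y ∧ prec w t


namespace InverseSemigroup

lemma inv_eq_self {e : α} (he : IsIdempotentElem e) : e⁻¹ = e :=
  (inv_unique e e (by rw [he.eq, he.eq]) (by rw [he.eq, he.eq])).symm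

lemma inv_inv' (x : α) : x⁻¹⁻¹ = x :=
  (inv_unique x⁻¹ x (inv_mul_inv x) (mul_inv_mul x)).symm

lemma isIdempotentElem_mul_inv (x : α) : IsIdempotentElem (x * x⁻¹) := by
  rw [IsIdempotentElem, ← mul_assoc, mul_inv_mul]

lemma isIdempotentElem_inv_mul (x : α) : IsIdempotentElem (x⁻¹ * x) := by
  rw [IsIdempotentElem, ← mul_assoc, inv_mul_inv]

lemma isIdempotentElem_mul {e f : α} (he : IsIdempotentElem e) (hf : IsIdempotentElem f) :
    IsIdempotentElem (e * f) := by
  have he' (z : α) : e * (e * z) = e * z := by rw [← mul_assoc, he.eq]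
  have hf' (z : α) : f * (f * z) = f * z := by rw [← mul_assoc, hf.eq]
  have h₁ := mul_inv_mul (e * f)
  have h₂ := inv_mul_inv (e * f)
  have h₃ := inv_unique (e * f)
  have h₄ := inv_unique (e * f)⁻¹ (e * f) h₂ h₁
  generalize (e * f)⁻¹ = a at *
  have hfae : f * a * e = a := by
    apply h₃
    · simpa only [mul_assoc, he', hf'] using h₁
    · have := congrArg (fun z => f * z * e) h₂
      simpa only [mul_assoc, he', hf'] using this
  have ha : IsIdempotentElem a := by
    rw [IsIdempotentElem]
    calc a * a = (f * a * e) * (f * a * e) := by rw [hfae]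
      _ = f * (a * (e * f) * a) * e := by simp only [mul_assoc]
      _ = a := by rw [h₂, hfae]
  rw [h₄, inv_eq_self ha]
  exact ha

lemma mul_comm_of_isIdempotentElem {e f : α} (he : IsIdempotentElem e)
    (hf : IsIdempotentElem f) : e * f = f * e := by
  have he' (z : α) : e * (e * z) = e * z := by rw [← mul_assoc, he.eq]
  have hf' (z : α) : f * (f * z) = f * z := by rw [← mul_assoc, hf.eq]
  have hef := isIdempotentElem_mul he hf
  have hfe := isIdempotentElem_mul hf he
  rw [← inv_eq_self hef]
  symm
  apply inv_unique
  · simpa only [mul_assoc, he', hf'] using hef.eq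
  · simpa only [mul_assoc, he', hf'] using hfe.eq

lemma mul_inv_rev' (x y : α) : (x * y)⁻¹ = y⁻¹ * x⁻¹ := by
  have hc := mul_comm_of_isIdempotentElem (isIdempotentElem_mul_inv y)
    (isIdempotentElem_inv_mul x)
  symm
  apply inv_unique
  · calc x * y * (y⁻¹ * x⁻¹) * (x * y) = x * ((y * y⁻¹) * (x⁻¹ * x)) * y := by
          simp only [mul_assoc]
      _ = (x * x⁻¹ * x) * (y * y⁻¹ * y) := by rw [hc]; simp only [mul_assoc]
      _ = x * y := by rw [mul_inv_mul, mul_inv_mul]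
  · calc y⁻¹ * x⁻¹ * (x * y) * (y⁻¹ * x⁻¹) = y⁻¹ * ((x⁻¹ * x) * (y * y⁻¹)) * x⁻¹ := by
          simp only [mul_assoc]
      _ = (y⁻¹ * y * y⁻¹) * (x⁻¹ * x * x⁻¹) := by rw [← hc]; simp only [mul_assoc]
      _ = y⁻¹ * x⁻¹ := by rw [inv_mul_inv, inv_mul_inv]

lemma isIdempotentElem_conj {p : α} (hp : IsIdempotentElem p) (x : α) :
    IsIdempotentElem (x * p * x⁻¹) := by
  have hc := mul_comm_of_isIdempotentElem hp (isIdempotentElem_inv_mul x)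
  calc x * p * x⁻¹ * (x * p * x⁻¹) = x * (p * (x⁻¹ * x)) * p * x⁻¹ := by simp only [mul_assoc]
    _ = (x * x⁻¹ * x) * (p * p) * x⁻¹ := by rw [hc]; simp only [mul_assoc]
    _ = x * p * x⁻¹ := by rw [mul_inv_mul, hp.eq]

lemma isIdempotentElem_conj' {p : α} (hp : IsIdempotentElem p) (x : α) :
    IsIdempotentElem (x⁻¹ * p * x) := by
  simpa only [inv_inv'] using isIdempotentElem_conj hp x⁻¹

end InverseSemigroup

open InverseSemigroup

lemma IsIdem.isIdempotentElem {p : α} (hp : IsIdem p) : IsIdempotentElem p := by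
  rw [hp]
  exact isIdempotentElem_mul_inv p

/-- Below an idempotent, the natural order only contains idempotents. -/
lemma prec_idempotent_iff {y e : α} (he : IsIdempotentElem e) :
    prec y e ↔ IsIdempotentElem y ∧ y * e = y := by
  rw [prec, inv_eq_self he]
  refine ⟨fun h => ?_, fun ⟨hy, h⟩ => by rw [h, inv_eq_self hy, hy.eq]⟩
  have h' : y * y⁻¹ = e * y⁻¹ := by
    have := congrArg (·⁻¹) h
    simpa only [mul_inv_rev', inv_inv', inv_eq_self he] using this.symm
  have hy : IsIdempotentElem y := by
    rw [← mul_inv_mul y, h', mul_assoc]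
    exact isIdempotentElem_mul he (isIdempotentElem_inv_mul y)
  exact ⟨hy, by rw [h, inv_eq_self hy, hy.eq]⟩

/-- if p < (p₁,…,pₙ) with all p, pᵢ idempotent and p ≺ x⁻¹·x,
then x·p·x⁻¹ < (x·p₁·x⁻¹,…,x·pₙ·x⁻¹). -/
theorem stmt15 [DecidableEq α] {z0 : α} (hz : IsZeroEl z0)
    {p : α} {s : Finset α} (hp : IsIdem p) (hs : ∀ q ∈ s, IsIdem q)
    {x : α} (hpx : prec p (x⁻¹ * x)) (h : ltS z0 p s) :
    ltS z0 (x * p * x⁻¹) (s.image fun q => x * q * x⁻¹) := by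
  have hp' := hp.isIdempotentElem
  intro y hy hy0
  obtain ⟨hyi, hye⟩ := (prec_idempotent_iff (isIdempotentElem_conj hp' x)).1 hy
  have hpx' : p * (x⁻¹ * x) = p := ((prec_idempotent_iff (isIdempotentElem_inv_mul x)).1 hpx).2
  have hyx : y * (x * x⁻¹) = y := by
    calc y * (x * x⁻¹) = y * (x * p * x⁻¹) * (x * x⁻¹) := by rw [hye]
      _ = y * (x * p * (x⁻¹ * x * x⁻¹)) := by simp only [mul_assoc]
      _ = y := by rw [inv_mul_inv, hye]
  have hxy : x * x⁻¹ * y = y := by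
    rw [mul_comm_of_isIdempotentElem (isIdempotentElem_mul_inv x) hyi, hyx]
  have hconj : x * (x⁻¹ * y * x) * x⁻¹ = y := by
    calc x * (x⁻¹ * y * x) * x⁻¹ = (x * x⁻¹ * y) * (x * x⁻¹) := by simp only [mul_assoc]
      _ = y := by rw [hxy, hyx]
  have hyp : x⁻¹ * y * x * p = x⁻¹ * y * x := by
    calc x⁻¹ * y * x * p = x⁻¹ * (y * (x * p * x⁻¹)) * x := by
          conv_lhs => rw [← hpx']
          simp only [mul_assoc]
      _ = x⁻¹ * y * x := by rw [hye]
  have hyi' := isIdempotentElem_conj' hyi x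
  obtain ⟨t, hts, w, hw0, hwy, hwt⟩ := h (x⁻¹ * y * x)
    ((prec_idempotent_iff hp').2 ⟨hyi', hyp⟩)
    (fun h0 => hy0 (by rw [← hconj, h0, (hz x).2, (hz _).1]))
  have hti := (hs t hts).isIdempotentElem
  obtain ⟨hwi, hwy⟩ := (prec_idempotent_iff hyi').1 hwy
  have hwt := ((prec_idempotent_iff hti).1 hwt).2
  have hwx : w * (x⁻¹ * x) = w := by
    calc w * (x⁻¹ * x) = w * (x⁻¹ * y * x) * (x⁻¹ * x) := by rw [hwy]
      _ = w * (x⁻¹ * y * (x * x⁻¹ * x)) := by simp only [mul_assoc]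
      _ = w := by rw [mul_inv_mul, hwy]
  have hxw : x⁻¹ * x * w = w := by
    rw [mul_comm_of_isIdempotentElem (isIdempotentElem_inv_mul x) hwi, hwx]
  have hwconj : x⁻¹ * (x * w * x⁻¹) * x = w := by
    calc x⁻¹ * (x * w * x⁻¹) * x = (x⁻¹ * x * w) * (x⁻¹ * x) := by simp only [mul_assoc]
      _ = w := by rw [hxw, hwx]
  have hwi' := isIdempotentElem_conj hwi x
  refine ⟨x * t * x⁻¹, Finset.mem_image_of_mem _ hts, x * w * x⁻¹,
    fun h0 => hw0 (by rw [← hwconj, h0, (hz _).2, (hz _).1]),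
    (prec_idempotent_iff hyi).2 ⟨hwi', ?_⟩,
    (prec_idempotent_iff (isIdempotentElem_conj hti x)).2 ⟨hwi', ?_⟩⟩
  · calc x * w * x⁻¹ * y = x * w * x⁻¹ * (y * (x * x⁻¹)) := by rw [hyx]
      _ = x * (w * (x⁻¹ * y * x)) * x⁻¹ := by simp only [mul_assoc]
      _ = x * w * x⁻¹ := by rw [hwy]
  · calc x * w * x⁻¹ * (x * t * x⁻¹) = x * (w * (x⁻¹ * x) * t) * x⁻¹ := by
          simp only [mul_assoc]
      _ = x * w * x⁻¹ := by rw [hwx, hwt]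
end

section
/- Let Γ be an inverse semigroup with zero. (a) For any subset I ⊆ Γ⁽⁰⁾, the set Cl(I) := {p ∈ Γ⁽⁰⁾ : p < (p₁,…,pₙ) for some n and some p₁,…,pₙ ∈ I} is the smallest <-closed subset of Γ⁽⁰⁾ containing I; that is, Cl(I) contains I, Cl(I) is <-closed, and Cl(I) is contained in every <-closed subset of Γ⁽⁰⁾ containing I. (b) If in addition I is an invariant order ideal in Γ⁽⁰⁾, then Cl(I) is invariant, hence the smallest <-closed invariant subset of Γ⁽⁰⁾ containing I. -/
variable {α : Type*} [InverseSemigroup α]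

/-- A subset I of the idempotents is <-closed if it contains every idempotent p
with p < (p₁,…,pₙ) for some finite family p₁,…,pₙ in I. -/
def LtClosed (z0 : α) (I : Set α) : Prop :=
  ∀ p : α, IsIdem p → (∃ s : Finset α, ↑s ⊆ I ∧ ltS z0 p s) → p ∈ I

/-- Cl(I): the set of idempotents p with p < (p₁,…,pₙ) for some finite family
p₁,…,pₙ in I. -/
def ClSet (z0 : α) (I : Set α) : Set α :=
  {p | IsIdem p ∧ ∃ s : Finset α, ↑s ⊆ I ∧ ltS z0 p s}

/-- A subset I of the idempotents is invariant if x·p·x⁻¹ ∈ I whenever p ∈ I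
and p ≺ x⁻¹·x. -/
def InvariantSet (I : Set α) : Prop :=
  ∀ p ∈ I, ∀ x : α, prec p (x⁻¹ * x) → x * p * x⁻¹ ∈ I

/-- A subset I of the idempotents is an order ideal if q ∈ I whenever q is an
idempotent with q ≺ p for some p ∈ I. -/
def OrderIdealSet (I : Set α) : Prop :=
  ∀ p ∈ I, ∀ q : α, IsIdem q → prec q p → q ∈ I

namespace InverseSemigroup

variable {Γ : Type*} [InverseSemigroup Γ]

lemma inv_inv_eq (x : Γ) : (x⁻¹)⁻¹ = x :=
  (inv_unique _ _ (inv_mul_inv x) (mul_inv_mul x)).symm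

lemma inv_eq_self_of_mul_self {e : Γ} (he : e * e = e) : e⁻¹ = e :=
  (inv_unique e e (by rw [he, he]) (by rw [he, he])).symm

lemma isIdem_iff_mul_self {e : Γ} : IsIdem e ↔ e * e = e := by
  constructor
  · intro h
    have h1 : e * e = e * e⁻¹ * (e * e⁻¹) := by rw [← show e = e * e⁻¹ from h]
    rw [h1, ← mul_assoc, mul_inv_mul]
    exact h.symm
  · intro h
    rw [IsIdem, inv_eq_self_of_mul_self h, h]

lemma mul_mul_self_of_mul_self {e f : Γ} (he : e * e = e) (hf : f * f = f) :
    (e * f) * (e * f) = e * f := by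
  have he' (a : Γ) : e * (e * a) = e * a := by rw [← mul_assoc, he]
  have hf' (a : Γ) : f * (f * a) = f * a := by rw [← mul_assoc, hf]
  have h1 := mul_inv_mul (e * f)
  have h2 := inv_mul_inv (e * f)
  set x := (e * f)⁻¹ with hx
  have h2' (a : Γ) : x * (e * (f * (x * a))) = x * a := by
    simpa only [mul_assoc] using congrArg (· * a) h2
  have hfx : f * x * e = x := by
    refine inv_unique (e * f) _ ?_ ?_
    · simpa only [mul_assoc, he', hf'] using h1
    · simp only [mul_assoc, he', hf', h2']
  have hxx : x * x = x := by
    rw [← hfx]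
    simp only [mul_assoc, h2']
  have hxe : x = e * f := by
    rw [← inv_inv_eq (e * f), ← hx, inv_eq_self_of_mul_self hxx]
  rw [← hxe, hxx]

lemma mul_comm_of_mul_self {e f : Γ} (he : e * e = e) (hf : f * f = f) : e * f = f * e := by
  have he' (a : Γ) : e * (e * a) = e * a := by rw [← mul_assoc, he]
  have hf' (a : Γ) : f * (f * a) = f * a := by rw [← mul_assoc, hf]
  have hef := mul_mul_self_of_mul_self he hf
  have hfe := mul_mul_self_of_mul_self hf he
  rw [← inv_eq_self_of_mul_self hef]
  refine (inv_unique (e * f) (f * e) ?_ ?_).symm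
  · simpa only [mul_assoc, he', hf'] using hef
  · simpa only [mul_assoc, he', hf'] using hfe

lemma mul_inv_mul_self (x : Γ) : (x * x⁻¹) * (x * x⁻¹) = x * x⁻¹ := by
  rw [← mul_assoc, mul_inv_mul]

lemma inv_mul_mul_self (x : Γ) : (x⁻¹ * x) * (x⁻¹ * x) = x⁻¹ * x := by
  rw [← mul_assoc, inv_mul_inv]

lemma mul_inv_rev_eq (x y : Γ) : (x * y)⁻¹ = y⁻¹ * x⁻¹ := by
  have hc := mul_comm_of_mul_self (mul_inv_mul_self y) (inv_mul_mul_self x)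
  refine (inv_unique _ _ ?_ ?_).symm
  · calc x * y * (y⁻¹ * x⁻¹) * (x * y) = x * ((y * y⁻¹) * (x⁻¹ * x)) * y := by
          simp only [mul_assoc]
      _ = (x * x⁻¹ * x) * (y * y⁻¹ * y) := by rw [hc]; simp only [mul_assoc]
      _ = x * y := by rw [mul_inv_mul, mul_inv_mul]
  · calc y⁻¹ * x⁻¹ * (x * y) * (y⁻¹ * x⁻¹) = y⁻¹ * ((x⁻¹ * x) * (y * y⁻¹)) * x⁻¹ := by
          simp only [mul_assoc]
      _ = (y⁻¹ * y * y⁻¹) * (x⁻¹ * x * x⁻¹) := by rw [← hc]; simp only [mul_assoc]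
      _ = y⁻¹ * x⁻¹ := by rw [inv_mul_inv, inv_mul_inv]

/-- Below an idempotent, the natural order is the semilattice order of the idempotents. -/
lemma prec_iff_of_mul_self {x e : Γ} (he : e * e = e) :
    prec x e ↔ x * x = x ∧ x * e = x := by
  rw [prec, inv_eq_self_of_mul_self he]
  constructor
  · intro h
    have h' : e * x⁻¹ = x * x⁻¹ := by
      have := congrArg (·⁻¹) h
      simpa only [mul_inv_rev_eq, inv_inv_eq, inv_eq_self_of_mul_self he] using this
    have hx : e * (x⁻¹ * x) = x := by rw [← mul_assoc, h', mul_inv_mul]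
    have hxx : x * x = x := by
      have := mul_mul_self_of_mul_self he (inv_mul_mul_self x)
      rwa [hx] at this
    exact ⟨hxx, by rw [h, inv_eq_self_of_mul_self hxx, hxx]⟩
  · rintro ⟨hxx, hxe⟩
    rw [hxe, inv_eq_self_of_mul_self hxx, hxx]

lemma prec_trans_of_mul_self {x y e : Γ} (he : e * e = e) (hxy : prec x y) (hye : prec y e) :
    prec x e := by
  obtain ⟨hy, hye⟩ := (prec_iff_of_mul_self he).1 hye
  obtain ⟨hx, hxy⟩ := (prec_iff_of_mul_self hy).1 hxy
  exact (prec_iff_of_mul_self he).2 ⟨hx, by rw [← hxy, mul_assoc, hye]⟩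

lemma conj_mul_conj {p x : Γ} (hpx : p * (x⁻¹ * x) = p) (q : Γ) :
    (x * p * x⁻¹) * (x * q * x⁻¹) = x * (p * q) * x⁻¹ :=
  calc (x * p * x⁻¹) * (x * q * x⁻¹) = x * ((p * (x⁻¹ * x)) * q) * x⁻¹ := by
        simp only [mul_assoc]
    _ = x * (p * q) * x⁻¹ := by rw [hpx]

lemma inv_conj_conj {p x : Γ} (hp : p * p = p) (hpx : p * (x⁻¹ * x) = p) :
    x⁻¹ * (x * p * x⁻¹) * x = p := by
  have hxp : x⁻¹ * x * p = p := by
    rw [← mul_comm_of_mul_self hp (inv_mul_mul_self x), hpx]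
  calc x⁻¹ * (x * p * x⁻¹) * x = (x⁻¹ * x * p) * (x⁻¹ * x) := by simp only [mul_assoc]
    _ = p := by rw [hxp, hpx]

lemma conj_ne_zero {z p x : Γ} (hz : IsZeroEl z) (hp : p * p = p) (hpx : p * (x⁻¹ * x) = p)
    (h0 : p ≠ z) : x * p * x⁻¹ ≠ z := by
  intro h
  apply h0
  rw [← inv_conj_conj hp hpx, h, (hz x⁻¹).2, (hz x).1]

theorem subset_clSet (z : Γ) {I : Set Γ} (hI : ∀ p ∈ I, IsIdem p) : I ⊆ ClSet z I :=
  fun p hp => ⟨hI p hp, {p}, by simpa using hp, fun y hy hy0 =>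
    ⟨p, Finset.mem_singleton_self p, y, hy0, rfl, hy⟩⟩

theorem clSet_subset {z : Γ} {I J : Set Γ} (hJ : LtClosed z J) (hIJ : I ⊆ J) :
    ClSet z I ⊆ J :=
  fun p ⟨hp, s, hs, hlt⟩ => hJ p hp ⟨s, hs.trans hIJ, hlt⟩

theorem ltClosed_clSet (z : Γ) (I : Set Γ) :
    LtClosed z (ClSet z I) := by
  classical
  rintro p hp ⟨s, hs, hlt⟩
  choose! f hf using fun t (ht : t ∈ s) => (hs ht).2
  refine ⟨hp, s.biUnion f, ?_, ?_⟩
  · simpa using fun t ht => (hf t ht).1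
  · intro y hy hy0
    obtain ⟨t, ht, w, hw0, hwy, hwt⟩ := hlt y hy hy0
    obtain ⟨u, hu, v, hv0, hvw, hvu⟩ := (hf t ht).2 w hwt hw0
    have hyy := ((prec_iff_of_mul_self (isIdem_iff_mul_self.1 hp)).1 hy).1
    exact ⟨u, Finset.mem_biUnion.2 ⟨t, ht, hu⟩, v, hv0, prec_trans_of_mul_self hyy hvw hwy, hvu⟩

theorem invariantSet_clSet {z : Γ} (hz : IsZeroEl z) {I : Set Γ} (hI : ∀ p ∈ I, IsIdem p)
    (hord : OrderIdealSet I) (hinv : InvariantSet I) : InvariantSet (ClSet z I) := by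
  classical
  rintro p ⟨hp, s, hs, hlt⟩ x hpx
  rw [isIdem_iff_mul_self] at hp
  have hxx := inv_mul_mul_self x
  have hpx' := ((prec_iff_of_mul_self hxx).1 hpx).2
  have hconj : (x * p * x⁻¹) * (x * p * x⁻¹) = x * p * x⁻¹ := by rw [conj_mul_conj hpx', hp]
  have hsI (t : Γ) (ht : t ∈ s) : t * t = t := isIdem_iff_mul_self.1 (hI t (hs ht))
  refine ⟨isIdem_iff_mul_self.2 hconj, s.image fun t => x * (t * p) * x⁻¹, ?_, ?_⟩
  · intro q hq
    obtain ⟨t, ht, rfl⟩ := Finset.mem_image.1 (Finset.mem_coe.1 hq)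
    have htp := mul_mul_self_of_mul_self (hsI t ht) hp
    refine hinv _ (hord t (hs ht) _ (isIdem_iff_mul_self.2 htp) ?_) x ?_
    · refine (prec_iff_of_mul_self (hsI t ht)).2 ⟨htp, ?_⟩
      rw [mul_comm_of_mul_self (hsI t ht) hp, mul_assoc, hsI t ht]
    · exact (prec_iff_of_mul_self hxx).2 ⟨htp, by rw [mul_assoc, hpx']⟩
  · intro y hy hy0
    obtain ⟨hyy, hyp⟩ := (prec_iff_of_mul_self hconj).1 hy
    have hyx : y * (x * x⁻¹) = y := by
      rw [← hyp]
      simp only [mul_assoc]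
      rw [← mul_assoc x⁻¹ x x⁻¹, inv_mul_inv]
    have hyx' : y * ((x⁻¹)⁻¹ * x⁻¹) = y := by rwa [inv_inv_eq]
    have hy'y := conj_mul_conj hyx' y
    have hy'p := conj_mul_conj hyx' (x * p * x⁻¹)
    have hy'0 := conj_ne_zero hz hyy hyx' hy0
    have hxy' := inv_conj_conj hyy hyx'
    rw [inv_inv_eq] at hy'y hy'p hy'0 hxy'
    rw [hyy] at hy'y
    rw [hyp, inv_conj_conj hp hpx'] at hy'p
    have hxy : x * (x⁻¹ * y * x) * x⁻¹ = y := hxy'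
    have hy' : prec (x⁻¹ * y * x) p := (prec_iff_of_mul_self hp).2 ⟨hy'y, hy'p⟩
    obtain ⟨t, ht, w, hw0, hwy, hwt⟩ := hlt _ hy' hy'0
    have hwp := ((prec_iff_of_mul_self hp).1 (prec_trans_of_mul_self hp hwy hy')).2
    obtain ⟨hww, hwy⟩ := (prec_iff_of_mul_self hy'y).1 hwy
    have hwt := ((prec_iff_of_mul_self (hsI t ht)).1 hwt).2
    have hwx : w * (x⁻¹ * x) = w := by rw [← hwp, mul_assoc, hpx']
    have htp := mul_mul_self_of_mul_self (hsI t ht) hp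
    have htpx : t * p * (x⁻¹ * x) = t * p := by rw [mul_assoc, hpx']
    have hwc : (x * w * x⁻¹) * (x * w * x⁻¹) = x * w * x⁻¹ := by rw [conj_mul_conj hwx, hww]
    refine ⟨_, Finset.mem_image_of_mem _ ht, x * w * x⁻¹, conj_ne_zero hz hww hwx hw0, ?_, ?_⟩
    · refine (prec_iff_of_mul_self hyy).2 ⟨hwc, ?_⟩
      rw [← hxy, conj_mul_conj hwx, hwy]
    · refine (prec_iff_of_mul_self (by rw [conj_mul_conj htpx, htp])).2 ⟨hwc, ?_⟩
      rw [conj_mul_conj hwx, ← mul_assoc w, hwt, hwp]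

end InverseSemigroup

/-- (a) Cl(I) is the smallest <-closed subset of the idempotents
containing I; (b) if I is moreover an invariant order ideal, Cl(I) is invariant,
hence the smallest <-closed invariant subset of the idempotents containing I. -/
theorem stmt19 {z0 : α} (hz : IsZeroEl z0)
    (I : Set α) (hI : ∀ p ∈ I, IsIdem p) :
    (I ⊆ ClSet z0 I ∧ LtClosed z0 (ClSet z0 I) ∧
      (∀ J : Set α, (∀ p ∈ J, IsIdem p) → LtClosed z0 J → I ⊆ J →
        ClSet z0 I ⊆ J)) ∧
    (OrderIdealSet I → InvariantSet I →
      InvariantSet (ClSet z0 I) ∧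
      (∀ J : Set α, (∀ p ∈ J, IsIdem p) → LtClosed z0 J → InvariantSet J →
        I ⊆ J → ClSet z0 I ⊆ J)) := by
  exact ⟨⟨InverseSemigroup.subset_clSet z0 hI, InverseSemigroup.ltClosed_clSet z0 I,
      fun _ _ hJ hIJ => InverseSemigroup.clSet_subset hJ hIJ⟩,
    fun hord hinv => ⟨InverseSemigroup.invariantSet_clSet hz hI hord hinv,
      fun _ _ hJ _ hIJ => InverseSemigroup.clSet_subset hJ hIJ⟩⟩
end
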